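/- Let d₁ > d₂ ≥ 1 have different parities. Then the space of pairs (f₁, f₂) of real homogeneous polynomials in two variables of degrees d₁ and d₂ with no common zero in ℝ² ∖ {0} has exactly two connected components, each of which has trivial reduced integer cohomology. -/

import Mathlib

open CategoryTheory

/-- The singular chain complex functor with coefficients in `R`. -/
noncomputable def singularChainComplexFunctor (R : Type) [CommRing R] :
    TopCat ⥤ ChainComplex (ModuleCat R) ℕ :=
  TopCat.toSSet ⋙ ((SimplicialObject.whiskering _ _).obj (ModuleCat.free R)) ⋙
    AlgebraicTopology.alternatingFaceMapComplex (ModuleCat R)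

/-- Singular cohomology of `X` with coefficients in `R`: the homology of the `R`-dual of
the singular chain complex. -/
noncomputable def singularCohomology (R : Type) [CommRing R] (X : TopCat) (n : ℕ) :
    ModuleCat R :=
  ((((linearYoneda R (ModuleCat R)).obj (ModuleCat.of R R)).mapHomologicalComplex _).obj
      ((singularChainComplexFunctor R).obj X).op).homology n

/-- The binary form of degree `d` with coefficients `a`, evaluated at `v ∈ ℝ²`. -/
def evalForm (d : ℕ) (a : Fin (d + 1) → ℝ) (v : ℝ × ℝ) : ℝ :=
  ∑ i : Fin (d + 1), a i * v.1 ^ (d - (i : ℕ)) * v.2 ^ (i : ℕ)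

/-- The space of non-resultant pairs of real binary forms of degrees `d₁` and `d₂`:
pairs of coefficient vectors whose forms have no common zero in `ℝ² ∖ {0}`. -/
def NonResultantPairs (d₁ d₂ : ℕ) : Type :=
  {fg : (Fin (d₁ + 1) → ℝ) × (Fin (d₂ + 1) → ℝ) //
    ∀ v : ℝ × ℝ, v ≠ 0 → ¬(evalForm d₁ fg.1 v = 0 ∧ evalForm d₂ fg.2 v = 0)}

instance (d₁ d₂ : ℕ) : TopologicalSpace (NonResultantPairs d₁ d₂) :=
  instTopologicalSpaceSubtype

section SingularCohomology

/-- Homotopic maps induce homotopic maps on singular chains. -/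
noncomputable def singularChainComplexFunctorMapHomotopy (R : Type) [CommRing R] {X Y : TopCat}
    {f g : X ⟶ Y} (H : TopCat.Homotopy f g) :
    Homotopy ((singularChainComplexFunctor R).map f) ((singularChainComplexFunctor R).map g) :=
  (H.toSSet.toSimplicialObjectHomotopy.whiskerRight (ModuleCat.free R)).toChainHomotopy

/-- A homotopy equivalence of chain complexes induces one on the opposite complexes. -/
noncomputable def HomotopyEquiv.opposite {V ι : Type*} [Category V] [Preadditive V]
    {c : ComplexShape ι} {K L : HomologicalComplex V c} (e : HomotopyEquiv K L) :
    HomotopyEquiv L.op K.op where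
  hom := (HomologicalComplex.opFunctor V c).map e.hom.op
  inv := (HomologicalComplex.opFunctor V c).map e.inv.op
  homotopyHomInvId := e.homotopyInvHomId.op
  homotopyInvHomId := e.homotopyHomInvId.op

/-- The singular chains of a contractible space are homotopy equivalent to `R` in degree `0`. -/
noncomputable def singularChainComplexOfContractible (R : Type) [CommRing R] (X : TopCat)
    (e : ContinuousMap.HomotopyEquiv X PUnit.{1}) :
    HomotopyEquiv ((singularChainComplexFunctor R).obj X)
      ((ChainComplex.single₀ (ModuleCat R)).obj ((ModuleCat.free R).obj PUnit.{1})) :=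
  HomotopyEquiv.trans (D := (singularChainComplexFunctor R).obj (TopCat.of PUnit.{1}))
    { hom := (singularChainComplexFunctor R).map (TopCat.ofHom e.toFun)
      inv := (singularChainComplexFunctor R).map (TopCat.ofHom e.invFun)
      homotopyHomInvId := (Homotopy.ofEq (Functor.map_comp _ _ _).symm).trans
        ((singularChainComplexFunctorMapHomotopy R
          (f := TopCat.ofHom e.toFun ≫ TopCat.ofHom e.invFun) (g := 𝟙 X) e.left_inv.some).trans
          (Homotopy.ofEq (CategoryTheory.Functor.map_id _ _)))
      homotopyInvHomId := (Homotopy.ofEq (Functor.map_comp _ _ _).symm).trans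
        ((singularChainComplexFunctorMapHomotopy R
          (f := TopCat.ofHom e.invFun ≫ TopCat.ofHom e.toFun) (g := 𝟙 _) e.right_inv.some).trans
          (Homotopy.ofEq (CategoryTheory.Functor.map_id _ _))) }
    ((HomotopyEquiv.ofIso ((AlgebraicTopology.alternatingFaceMapComplex _).mapIso
      (((SimplicialObject.whiskering _ _).obj (ModuleCat.free R)).mapIso
        (TopCat.toSSetIsoConst (TopCat.of PUnit.{1})) ≪≫ Functor.constComp _ _ _))).trans
      (SimplicialObject.Augmented.ExtraDegeneracy.const _).homotopyEquiv)

/-- The singular cohomology of a contractible space is that of a complex concentrated in degree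
`0`. -/
noncomputable def singularCohomologyOfContractible (R : Type) [CommRing R] (X : TopCat)
    (e : ContinuousMap.HomotopyEquiv X PUnit.{1}) (n : ℕ) : singularCohomology R X n ≅
    ((((linearYoneda R (ModuleCat R)).obj (ModuleCat.of R R)).mapHomologicalComplex _).obj
      ((ChainComplex.single₀ (ModuleCat R)).obj ((ModuleCat.free R).obj PUnit.{1})).op).homology
        n :=
  ((((linearYoneda R (ModuleCat R)).obj (ModuleCat.of R R)).mapHomotopyEquiv
    (singularChainComplexOfContractible R X e).opposite).toHomologyIso n).symm

open Limits in
lemma subsingleton_singularCohomology_of_contractible (R : Type) [CommRing R] (X : TopCat)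
    [ContractibleSpace X] {n : ℕ} (hn : n ≠ 0) : Subsingleton (singularCohomology R X n) := by
  refine ModuleCat.subsingleton_of_isZero (IsZero.of_iso ?_ (singularCohomologyOfContractible R X
    (ContractibleSpace.hequiv X PUnit).some n))
  apply ShortComplex.isZero_homology_of_isZero_X₂
  exact Functor.map_isZero ((linearYoneda R (ModuleCat R)).obj (ModuleCat.of R R))
    (HomologicalComplex.isZero_single_obj_X _ _ _ _ hn).op

open Limits in
lemma singularCohomology_zero_of_contractible (R : Type) [CommRing R] (X : TopCat)
    [ContractibleSpace X] : Nonempty (singularCohomology R X 0 ≃ₗ[R] R) := by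
  let K := ((((linearYoneda R (ModuleCat R)).obj (ModuleCat.of R R)).mapHomologicalComplex _).obj
      ((ChainComplex.single₀ (ModuleCat R)).obj ((ModuleCat.free R).obj PUnit.{1})).op)
  have hK (i j : ℕ) : K.d i j = 0 := by
    change ((linearYoneda R (ModuleCat R)).obj (ModuleCat.of R R)).map
      (((ChainComplex.single₀ (ModuleCat R)).obj ((ModuleCat.free R).obj PUnit.{1})).d j i).op = 0
    rw [HomologicalComplex.single_obj_d, op_zero]
    exact Functor.map_zero _ _ _
  let e₁ : singularCohomology R X 0 ≅ K.homology 0 :=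
    singularCohomologyOfContractible R X (ContractibleSpace.hequiv X PUnit).some 0
  let e₂ : K.homology 0 ≅ K.X 0 :=
    (ShortComplex.HomologyData.ofZeros (K.sc 0) (hK _ _) (hK _ _)).left.homologyIso
  let e₃ : (K.X 0 : Type) ≃ₗ[R] R := (ModuleCat.homLinearEquiv (S := R)).trans
    ((Finsupp.llift R R R PUnit.{1}).symm.trans (LinearEquiv.funUnique PUnit.{1} R R))
  exact ⟨(e₁ ≪≫ e₂).toLinearEquiv.trans e₃⟩

end SingularCohomology

section Discrete

open unitInterval

variable {X Y : Type*} [TopologicalSpace X] [TopologicalSpace Y]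

lemma ContinuousMap.HomotopyEquiv.joined_invFun_apply (e : ContinuousMap.HomotopyEquiv X Y)
    (x : X) : Joined (e.invFun (e.toFun x)) x :=
  e.left_inv.elim fun H ↦ ⟨⟨(H : C(I × X, X)).comp (.prodMk (.id I) (.const I x)),
    by simp, by simp⟩⟩

lemma Joined.mem_connectedComponent {x y : X} (h : Joined x y) : y ∈ connectedComponent x :=
  pathComponent_subset_component x h

variable [DiscreteTopology Y]

lemma ContinuousMap.HomotopyEquiv.toFun_invFun_apply_of_discrete
    (e : ContinuousMap.HomotopyEquiv X Y) (y : Y) : e.toFun (e.invFun y) = y := by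
  have h := (e.symm.joined_invFun_apply y).mem_connectedComponent
  rw [connectedComponent_eq_singleton] at h
  exact h.symm

/-- The connected components of a space homotopy equivalent to a discrete space are the points of
that discrete space. -/
def ContinuousMap.HomotopyEquiv.connectedComponentsEquiv (e : ContinuousMap.HomotopyEquiv X Y) :
    ConnectedComponents X ≃ Y where
  toFun := e.toFun.continuous.connectedComponentsLift
  invFun y := ConnectedComponents.mk (e.invFun y)
  left_inv c := by
    obtain ⟨x, rfl⟩ := ConnectedComponents.surjective_coe c
    rw [Continuous.connectedComponentsLift_apply_coe]
    exact ConnectedComponents.coe_eq_coe'.2 (e.joined_invFun_apply x).symm.mem_connectedComponent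
  right_inv y := by
    rw [Continuous.connectedComponentsLift_apply_coe]
    exact e.toFun_invFun_apply_of_discrete y

lemma ContinuousMap.HomotopyEquiv.contractibleSpace_connectedComponent
    (e : ContinuousMap.HomotopyEquiv X Y) (x : X) : ContractibleSpace (connectedComponent x) := by
  rw [contractible_iff_id_nullhomotopic]
  obtain ⟨H⟩ := e.left_inv.symm
  have hH (t : I) (y : X) (hy : y ∈ connectedComponent x) : H (t, y) ∈ connectedComponent x := by
    rw [connectedComponent_eq hy]
    exact Joined.mem_connectedComponent
      ⟨⟨(H : C(I × X, X)).comp (.prodMk ⟨fun s ↦ s * t, by fun_prop⟩ (.const I y)),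
        by simp, by simp⟩⟩
  have he (y : connectedComponent x) : e.toFun y.1 = e.toFun x :=
    e.toFun.continuous.image_eq_of_connectedComponent_eq _ _ (connectedComponent_eq y.2).symm
  refine ⟨⟨e.invFun (e.toFun x), (e.joined_invFun_apply x).symm.mem_connectedComponent⟩,
    ⟨⟨⟨fun p ↦ ⟨H (p.1, p.2.1), hH p.1 p.2.1 p.2.2⟩, ?_⟩, fun y ↦ ?_, fun y ↦ ?_⟩⟩⟩
  · fun_prop
  · simp
  · ext1
    simp [he]

end Discrete

section Forms

lemma continuous_evalForm (d : ℕ) :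
    Continuous fun p : (Fin (d + 1) → ℝ) × (ℝ × ℝ) ↦ evalForm d p.1 p.2 := by
  unfold evalForm
  fun_prop

lemma evalForm_add (d : ℕ) (a b : Fin (d + 1) → ℝ) (v : ℝ × ℝ) :
    evalForm d (a + b) v = evalForm d a v + evalForm d b v := by
  simp only [evalForm, Pi.add_apply, add_mul, Finset.sum_add_distrib]

lemma evalForm_smul (d : ℕ) (c : ℝ) (a : Fin (d + 1) → ℝ) (v : ℝ × ℝ) :
    evalForm d (c • a) v = c * evalForm d a v := by
  simp only [evalForm, Pi.smul_apply, smul_eq_mul, Finset.mul_sum, mul_assoc]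

/-- Evaluation of binary forms at `v`, as a linear map in the coefficients. -/
def evalFormₗ (d : ℕ) (v : ℝ × ℝ) : (Fin (d + 1) → ℝ) →ₗ[ℝ] ℝ where
  toFun a := evalForm d a v
  map_add' a b := evalForm_add d a b v
  map_smul' c a := evalForm_smul d c a v

lemma evalForm_zero_left (d : ℕ) (v : ℝ × ℝ) : evalForm d 0 v = 0 :=
  map_zero (evalFormₗ d v)

lemma evalForm_sum {ι : Type*} (d : ℕ) (s : Finset ι) (a : ι → Fin (d + 1) → ℝ) (v : ℝ × ℝ) :
    evalForm d (∑ i ∈ s, a i) v = ∑ i ∈ s, evalForm d (a i) v :=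
  map_sum (evalFormₗ d v) a s

lemma evalForm_smul_right (d : ℕ) (a : Fin (d + 1) → ℝ) (c : ℝ) (v : ℝ × ℝ) :
    evalForm d a (c • v) = c ^ d * evalForm d a v := by
  simp only [evalForm, Finset.mul_sum, Prod.smul_fst, Prod.smul_snd, smul_eq_mul, mul_pow]
  refine Finset.sum_congr rfl fun i _ ↦ ?_
  have h : c ^ d = c ^ (d - (i : ℕ)) * c ^ (i : ℕ) := by
    rw [← pow_add, Nat.sub_add_cancel (Nat.lt_succ_iff.1 i.2)]
  rw [h]
  ring

lemma evalForm_snoc_zero (d : ℕ) (a : Fin (d + 1) → ℝ) (v : ℝ × ℝ) :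
    evalForm (d + 1) (Fin.snoc (α := fun _ ↦ ℝ) a 0) v = v.1 * evalForm d a v := by
  simp only [evalForm, Fin.sum_univ_castSucc (n := d + 1), Fin.snoc_castSucc, Fin.snoc_last,
    Finset.mul_sum, Fin.val_castSucc, zero_mul, add_zero]
  refine Finset.sum_congr rfl fun i _ ↦ ?_
  rw [Nat.sub_add_comm (Nat.lt_succ_iff.1 i.2)]
  ring

lemma evalForm_cons_zero (d : ℕ) (a : Fin (d + 1) → ℝ) (v : ℝ × ℝ) :
    evalForm (d + 1) (Fin.cons (α := fun _ ↦ ℝ) 0 a) v = v.2 * evalForm d a v := by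
  simp only [evalForm, Fin.sum_univ_succ (n := d + 1), Fin.cons_zero, Fin.cons_succ,
    Finset.mul_sum, Fin.val_succ, zero_mul, zero_add]
  refine Finset.sum_congr rfl fun i _ ↦ ?_
  rw [Nat.add_sub_add_right]
  ring

lemma exists_evalForm_linear_mul (d : ℕ) (a : Fin (d + 1) → ℝ) (l : ℝ × ℝ) :
    ∃ b, ∀ v, evalForm (d + 1) b v = (l.1 * v.1 + l.2 * v.2) * evalForm d a v := by
  refine ⟨l.1 • Fin.snoc (α := fun _ ↦ ℝ) a 0 + l.2 • Fin.cons (α := fun _ ↦ ℝ) 0 a, fun v ↦ ?_⟩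
  rw [evalForm_add, evalForm_smul, evalForm_smul, evalForm_snoc_zero, evalForm_cons_zero]
  ring

/-- The coefficients of the product of a binary form with `x ^ 2 + y ^ 2`. -/
def mulNormSq (d : ℕ) (a : Fin (d + 1) → ℝ) : Fin (d + 2 + 1) → ℝ :=
  Fin.snoc (α := fun _ ↦ ℝ) (Fin.snoc (α := fun _ ↦ ℝ) a 0) 0 +
    Fin.cons (α := fun _ ↦ ℝ) 0 (Fin.cons (α := fun _ ↦ ℝ) 0 a)

lemma continuous_mulNormSq (d : ℕ) : Continuous (mulNormSq d) := by
  unfold mulNormSq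
  fun_prop

lemma evalForm_mulNormSq (d : ℕ) (a : Fin (d + 1) → ℝ) (v : ℝ × ℝ) :
    evalForm (d + 2) (mulNormSq d a) v = (v.1 ^ 2 + v.2 ^ 2) * evalForm d a v := by
  rw [mulNormSq, evalForm_add, evalForm_snoc_zero, evalForm_snoc_zero, evalForm_cons_zero,
    evalForm_cons_zero]
  ring

lemma normSq_pos_of_ne_zero {v : ℝ × ℝ} (hv : v ≠ 0) : 0 < v.1 ^ 2 + v.2 ^ 2 := by
  by_contra! h
  exact hv (Prod.ext (by simp; nlinarith [sq_nonneg v.1, sq_nonneg v.2])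
    (by simp; nlinarith [sq_nonneg v.1, sq_nonneg v.2]))

/-- The set of normalised representatives of the points of the real projective line. -/
def lineRepresentatives : Set (ℝ × ℝ) := {v | v.2 = 1 ∨ v = (1, 0)}

lemma ne_zero_of_mem_lineRepresentatives {v : ℝ × ℝ} (hv : v ∈ lineRepresentatives) : v ≠ 0 := by
  rintro rfl
  simp [lineRepresentatives, Prod.ext_iff] at hv

lemma det_ne_zero_of_mem_lineRepresentatives {v w : ℝ × ℝ} (hv : v ∈ lineRepresentatives)
    (hw : w ∈ lineRepresentatives) (hvw : v ≠ w) : v.2 * w.1 - v.1 * w.2 ≠ 0 := by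
  obtain ⟨v₁, v₂⟩ := v
  obtain ⟨w₁, w₂⟩ := w
  simp only [lineRepresentatives, Set.mem_ofPred_eq, Prod.mk.injEq] at hv hw
  intro h
  apply hvw
  rcases hv with rfl | ⟨rfl, rfl⟩ <;> rcases hw with rfl | ⟨rfl, rfl⟩ <;> simp_all
  exact hvw (by linarith)

lemma exists_smul_mem_lineRepresentatives {v : ℝ × ℝ} (hv : v ≠ 0) :
    ∃ c : ℝ, c ≠ 0 ∧ ∃ w ∈ lineRepresentatives, v = c • w := by
  by_cases h : v.2 = 0
  · refine ⟨v.1, fun h' ↦ hv (Prod.ext h' h), (1, 0), Or.inr rfl, ?_⟩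
    ext <;> simp [h]
  · refine ⟨v.2, h, (v.1 / v.2, 1), Or.inl rfl, ?_⟩
    ext <;> simp [mul_div_cancel₀, h]

lemma exists_evalForm_vanishing (T : Finset (ℝ × ℝ)) {u : ℝ × ℝ} (hu : u ∈ lineRepresentatives)
    (hT : ∀ w ∈ T, w ∈ lineRepresentatives) (huT : u ∉ T) {n : ℕ} (hn : T.card ≤ n) :
    ∃ a, evalForm n a u ≠ 0 ∧ ∀ w ∈ T, evalForm n a w = 0 := by
  induction T using Finset.induction_on generalizing n with
  | empty =>
    induction n with
    | zero => exact ⟨1, by simp [evalForm], by simp⟩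
    | succ n ih =>
      obtain ⟨a, ha, -⟩ := ih (Nat.zero_le _)
      obtain ⟨b, hb⟩ := exists_evalForm_linear_mul n a u
      refine ⟨b, ?_, by simp⟩
      rw [hb]
      refine mul_ne_zero ?_ ha
      have := normSq_pos_of_ne_zero (ne_zero_of_mem_lineRepresentatives hu)
      nlinarith
  | insert w T hw ih =>
    rw [Finset.card_insert_of_notMem hw] at hn
    obtain ⟨n, rfl⟩ : ∃ k, n = k + 1 := ⟨n - 1, by omega⟩
    obtain ⟨a, ha, haT⟩ := ih (fun x hx ↦ hT x (Finset.mem_insert_of_mem hx))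
      (fun h ↦ huT (Finset.mem_insert_of_mem h)) (n := n) (by omega)
    obtain ⟨b, hb⟩ := exists_evalForm_linear_mul n a (w.2, -w.1)
    refine ⟨b, ?_, fun x hx ↦ ?_⟩
    · rw [hb]
      refine mul_ne_zero ?_ ha
      have := det_ne_zero_of_mem_lineRepresentatives (hT w (Finset.mem_insert_self _ _)) hu
        (fun h ↦ huT (h ▸ Finset.mem_insert_self _ _))
      simpa [← sub_eq_add_neg] using this
    · rw [hb]
      obtain rfl | hx := Finset.mem_insert.1 hx
      · simp [mul_comm]
      · rw [haT x hx, mul_zero]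

lemma exists_evalForm_eq_on (T : Finset (ℝ × ℝ)) (hT : ∀ w ∈ T, w ∈ lineRepresentatives) {n : ℕ}
    (hn : T.card ≤ n + 1) (c : ℝ × ℝ → ℝ) : ∃ a, ∀ w ∈ T, evalForm n a w = c w := by
  have h (u : ℝ × ℝ) : ∃ a, u ∈ T → evalForm n a u ≠ 0 ∧ ∀ w ∈ T.erase u, evalForm n a w = 0 := by
    by_cases hu : u ∈ T
    · obtain ⟨a, ha⟩ := exists_evalForm_vanishing (T.erase u) (hT u hu)
        (fun w hw ↦ hT w (Finset.mem_of_mem_erase hw)) (Finset.notMem_erase u T) (n := n)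
        (by rw [Finset.card_erase_of_mem hu]; omega)
      exact ⟨a, fun _ ↦ ha⟩
    · exact ⟨0, fun h ↦ absurd h hu⟩
  choose a ha using h
  refine ⟨∑ u ∈ T, (c u / evalForm n (a u) u) • a u, fun w hw ↦ ?_⟩
  rw [evalForm_sum, Finset.sum_eq_single_of_mem w hw, evalForm_smul,
    div_mul_cancel₀ _ (ha w hw).1]
  intro u hu huw
  rw [evalForm_smul, (ha u hu).2 w (Finset.mem_erase.2 ⟨huw.symm, hw⟩), mul_zero]

lemma eq_zero_of_evalForm_eq_zero_on {m : ℕ} {b : Fin (m + 1) → ℝ} (T : Finset (ℝ × ℝ))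
    (hT : ∀ w ∈ T, w ∈ lineRepresentatives) (hm : T.card = m + 1)
    (hb : ∀ w ∈ T, evalForm m b w = 0) : b = 0 := by
  let L : (Fin (m + 1) → ℝ) →ₗ[ℝ] (T → ℝ) := LinearMap.pi fun w ↦ evalFormₗ m w
  have hL : Function.Surjective L := by
    intro c
    obtain ⟨a, ha⟩ := exists_evalForm_eq_on T hT hm.le
      (fun w ↦ if hw : w ∈ T then c ⟨w, hw⟩ else 0)
    refine ⟨a, funext fun w ↦ (ha w w.2).trans ?_⟩
    simp
  have hL' : Function.Injective L :=
    (LinearMap.injective_iff_surjective_of_finrank_eq_finrank (by simp [hm])).2 hL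
  refine hL' ?_
  rw [map_zero]
  exact funext fun w ↦ hb w w.2

lemma exists_finset_zeros {m : ℕ} {b : Fin (m + 1) → ℝ} (hb : b ≠ 0) :
    ∃ T : Finset (ℝ × ℝ), T.card ≤ m ∧
      ∀ w, w ∈ T ↔ w ∈ lineRepresentatives ∧ evalForm m b w = 0 := by
  have key (T : Finset (ℝ × ℝ)) (hT : (T : Set (ℝ × ℝ)) ⊆
      {w | w ∈ lineRepresentatives ∧ evalForm m b w = 0}) : T.card ≤ m := by
    by_contra! h
    obtain ⟨S, hS, hSm⟩ := Finset.exists_subset_card_eq (Nat.succ_le_of_lt h)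
    exact hb (eq_zero_of_evalForm_eq_zero_on S (fun w hw ↦ (hT (hS hw)).1) hSm
      (fun w hw ↦ (hT (hS hw)).2))
  have hfin : {w | w ∈ lineRepresentatives ∧ evalForm m b w = 0}.Finite := by
    by_contra h
    obtain ⟨T, hT, hTm⟩ := Set.Infinite.exists_subset_card_eq h (m + 1)
    exact absurd (key T hT) (by omega)
  exact ⟨hfin.toFinset, key _ (by simp), by simp⟩

end Forms

section NonResultantPairs

lemma isConnected_compl_zero_prod : _root_.IsConnected ({0}ᶜ : Set (ℝ × ℝ)) :=
  isConnected_compl_singleton_of_one_lt_rank (by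
    rw [rank_prod', Module.rank_self]; norm_num) (0 : ℝ × ℝ)

lemma exists_evalForm_mul_pos_of_forall_ne_zero {d : ℕ} {a : Fin (d + 2 + 1) → ℝ}
    (ha : ∀ v, v ≠ 0 → evalForm (d + 2) a v ≠ 0) :
    ∃ g, ∀ v, v ≠ 0 → 0 < evalForm (d + 2) a v * evalForm d g v := by
  have hsign : (∀ v, v ≠ 0 → 0 < evalForm (d + 2) a v) ∨
      (∀ v, v ≠ 0 → evalForm (d + 2) a v < 0) := by
    by_contra! h
    obtain ⟨⟨v, hv, hv'⟩, w, hw, hw'⟩ := h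
    obtain ⟨u, hu, hu'⟩ := isConnected_compl_zero_prod.isPreconnected.intermediate_value hv hw
      ((continuous_evalForm (d + 2)).comp (Continuous.prodMk_right a)).continuousOn ⟨hv', hw'⟩
    exact ha u hu hu'
  have heven : Even d := by
    by_contra h
    rw [Nat.not_even_iff_odd] at h
    have h' := evalForm_smul_right (d + 2) a (-1) (1, 0)
    rw [(h.add_even even_two).neg_one_pow] at h'
    rcases hsign with hs | hs <;>
      linarith [hs (1, 0) (by simp), hs ((-1 : ℝ) • (1, 0)) (by simp)]
  have hpos : ∃ g, ∀ v, v ≠ 0 → 0 < evalForm d g v := by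
    obtain ⟨k, rfl⟩ := heven.exists_two_nsmul
    clear * -
    induction k with
    | zero => exact ⟨1, by simp [evalForm]⟩
    | succ k ih =>
      obtain ⟨g, hg⟩ := ih
      refine ⟨mulNormSq _ g, fun v hv ↦ ?_⟩
      have := evalForm_mulNormSq (2 • k) g v
      exact this ▸ mul_pos (normSq_pos_of_ne_zero hv) (hg v hv)
  obtain ⟨g, hg⟩ := hpos
  rcases hsign with hs | hs
  · exact ⟨g, fun v hv ↦ mul_pos (hs v hv) (hg v hv)⟩
  · refine ⟨(-1 : ℝ) • g, fun v hv ↦ ?_⟩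
    rw [evalForm_smul]
    nlinarith [mul_pos (neg_pos.2 (hs v hv)) (hg v hv)]

lemma exists_evalForm_mul_pos {d m : ℕ} (hm : m ≤ d + 1) (p : NonResultantPairs (d + 2) m) :
    ∃ g, ∀ v, v ≠ 0 → evalForm m p.1.2 v = 0 →
      0 < evalForm (d + 2) p.1.1 v * evalForm d g v := by
  by_cases hb : p.1.2 = 0
  · obtain ⟨g, hg⟩ := exists_evalForm_mul_pos_of_forall_ne_zero (a := p.1.1)
      fun v hv h ↦ p.2 v hv ⟨h, by rw [hb, evalForm_zero_left]⟩
    exact ⟨g, fun v hv _ ↦ hg v hv⟩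
  · obtain ⟨T, hTm, hT⟩ := exists_finset_zeros hb
    obtain ⟨g, hg⟩ := exists_evalForm_eq_on T (fun w hw ↦ ((hT w).1 hw).1) (hTm.trans hm)
      (evalForm (d + 2) p.1.1)
    refine ⟨g, fun v hv hv0 ↦ ?_⟩
    obtain ⟨c, hc, w, hw, rfl⟩ := exists_smul_mem_lineRepresentatives hv
    have hw0 : evalForm m p.1.2 w = 0 := by
      rw [evalForm_smul_right] at hv0
      exact (mul_eq_zero.1 hv0).resolve_left (pow_ne_zero _ hc)
    have hne : evalForm (d + 2) p.1.1 w ≠ 0 := fun h ↦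
      p.2 w (ne_zero_of_mem_lineRepresentatives hw) ⟨h, hw0⟩
    rw [evalForm_smul_right, evalForm_smul_right, hg w ((hT w).2 ⟨hw, hw0⟩)]
    have : c ^ (d + 2) * evalForm (d + 2) p.1.1 w * (c ^ d * evalForm (d + 2) p.1.1 w) =
      (c ^ (d + 1) * evalForm (d + 2) p.1.1 w) ^ 2 := by ring
    rw [this]
    positivity

lemma isOpen_setOf_evalForm_mul_pos {d m : ℕ} (g : Fin (d + 1) → ℝ) :
    IsOpen {p : NonResultantPairs (d + 2) m | ∀ v, v ≠ 0 → evalForm m p.1.2 v = 0 →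
      0 < evalForm (d + 2) p.1.1 v * evalForm d g v} := by
  let S := Metric.sphere (0 : ℝ × ℝ) 1
  let Z : Set (NonResultantPairs (d + 2) m × S) := {q | evalForm m q.1.1.2 q.2 = 0 ∧
    evalForm (d + 2) q.1.1.1 q.2 * evalForm d g q.2 ≤ 0}
  have hval : Continuous (Subtype.val : NonResultantPairs (d + 2) m → _) := continuous_subtype_val
  have hZ : IsClosed Z := by
    have h₁ : Continuous fun q : NonResultantPairs (d + 2) m × S ↦ evalForm m q.1.1.2 q.2 :=
      (continuous_evalForm m).comp ((continuous_snd.comp (hval.comp continuous_fst)).prodMk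
        (continuous_subtype_val.comp continuous_snd))
    have h₂ : Continuous fun q : NonResultantPairs (d + 2) m × S ↦
        evalForm (d + 2) q.1.1.1 q.2 := (continuous_evalForm (d + 2)).comp
          ((continuous_fst.comp (hval.comp continuous_fst)).prodMk
            (continuous_subtype_val.comp continuous_snd))
    have h₃ : Continuous fun q : NonResultantPairs (d + 2) m × S ↦ evalForm d g q.2 :=
      (continuous_evalForm d).comp
        (continuous_const.prodMk (continuous_subtype_val.comp continuous_snd))
    exact (isClosed_eq h₁ continuous_const).inter (isClosed_le (h₂.mul h₃) continuous_const)
  convert (isClosedMap_fst_of_compactSpace _ hZ).isOpen_compl using 1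
  ext p
  simp only [Set.mem_ofPred_eq, Set.mem_compl_iff, Set.mem_image, Prod.exists, exists_and_right,
    exists_eq_right, not_exists]
  constructor
  · rintro h ⟨v, hv⟩ ⟨h₁, h₂⟩
    exact (h v (ne_zero_of_mem_unit_sphere ⟨v, hv⟩) h₁).not_ge h₂
  · intro h v hv h₀
    have hn : 0 < ‖v‖ := norm_pos_iff.2 hv
    have h' := h ⟨‖v‖⁻¹ • v, by simp [S, norm_smul, hn.ne']⟩
    by_contra hneg
    refine h' ⟨?_, ?_⟩
    · simp only [evalForm_smul_right, h₀, mul_zero]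
    · simp only [evalForm_smul_right]
      rw [mul_mul_mul_comm]
      exact mul_nonpos_of_nonneg_of_nonpos (by positivity) (not_lt.1 hneg)

instance (d m : ℕ) : TopologicalSpace.MetrizableSpace (NonResultantPairs d m) :=
  inferInstanceAs (TopologicalSpace.MetrizableSpace (Subtype _))

lemma exists_continuous_evalForm_mul_pos {d m : ℕ} (hm : m ≤ d + 1) :
    ∃ Φ : C(NonResultantPairs (d + 2) m, Fin (d + 1) → ℝ), ∀ p, ∀ v, v ≠ 0 →
      evalForm m p.1.2 v = 0 → 0 < evalForm (d + 2) p.1.1 v * evalForm d (Φ p) v := by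
  let _ := TopologicalSpace.metrizableSpaceMetric (NonResultantPairs (d + 2) m)
  refine exists_continuous_forall_mem_convex_of_local_const
    (t := fun p : NonResultantPairs (d + 2) m ↦ {g | ∀ v, v ≠ 0 → evalForm m p.1.2 v = 0 →
      0 < evalForm (d + 2) p.1.1 v * evalForm d g v}) (fun p ↦ ?_) fun p ↦ ?_
  · intro g hg g' hg' s t hs ht hst v hv h₀
    rw [evalForm_add, evalForm_smul, evalForm_smul]
    have h₁ := hg v hv h₀
    have h₂ := hg' v hv h₀
    have := (convex_Ioi (0 : ℝ)) h₁ h₂ hs ht hst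
    simp only [smul_eq_mul, Set.mem_Ioi] at this
    linarith
  · obtain ⟨g, hg⟩ := exists_evalForm_mul_pos hm p
    exact ⟨g, (isOpen_setOf_evalForm_mul_pos g).mem_nhds hg⟩

/-- Two maps to the space of non-resultant pairs are homotopic if their second components agree and
their first components have equal signs at the zeros of the second one. -/
lemma homotopic_of_evalForm_mul_pos {X : Type*} [TopologicalSpace X] {d m : ℕ}
    (f g : C(X, NonResultantPairs d m)) (h : ∀ x, (f x).1.2 = (g x).1.2)
    (hpos : ∀ x v, v ≠ 0 → evalForm m (f x).1.2 v = 0 →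
      0 < evalForm d (f x).1.1 v * evalForm d (g x).1.1 v) : f.Homotopic g := by
  have hval : Continuous (Subtype.val : NonResultantPairs d m → _) := continuous_subtype_val
  refine ⟨⟨⟨fun q ↦ ⟨((1 - (q.1 : ℝ)) • (f q.2).1.1 + (q.1 : ℝ) • (g q.2).1.1, (f q.2).1.2),
    fun v hv ⟨h₁, h₂⟩ ↦ ?_⟩, ?_⟩, fun x ↦ ?_, fun x ↦ ?_⟩⟩
  · have hp := hpos q.2 v hv h₂
    rw [evalForm_add, evalForm_smul, evalForm_smul] at h₁
    obtain ⟨⟨t, ht₀, ht₁⟩, x⟩ := q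
    dsimp only at *
    set A := evalForm d (f x).1.1 v
    set B := evalForm d (g x).1.1 v
    have hA : A ≠ 0 := left_ne_zero_of_mul hp.ne'
    have hA2 : 0 < A ^ 2 := by positivity
    have h₃ : (1 - t) * A ^ 2 + t * (A * B) = 0 := by linear_combination A * h₁
    rcases ht₀.eq_or_lt with rfl | ht
    · simp at h₃; exact hA h₃
    · nlinarith [mul_pos ht hp, mul_nonneg (sub_nonneg.2 ht₁) hA2.le]
  · exact Continuous.subtype_mk (by fun_prop) _
  · exact Subtype.ext (by simp)
  · exact Subtype.ext (by simp [h])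

theorem nonempty_homotopyEquiv_nonResultantPairs {d m : ℕ} (hm : m ≤ d + 1) :
    Nonempty (ContinuousMap.HomotopyEquiv (NonResultantPairs (d + 2) m)
      (NonResultantPairs d m)) := by
  obtain ⟨Φ, hΦ⟩ := exists_continuous_evalForm_mul_pos hm
  have hval (d m : ℕ) : Continuous (Subtype.val : NonResultantPairs d m → _) :=
    continuous_subtype_val
  have hval' := hval d m
  have hval'' := hval (d + 2) m
  have hmul := continuous_mulNormSq d
  let F : C(NonResultantPairs (d + 2) m, NonResultantPairs d m) :=
    ⟨fun p ↦ ⟨(Φ p, p.1.2), fun v hv h ↦ (right_ne_zero_of_mul (hΦ p v hv h.2).ne') h.1⟩,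
      Continuous.subtype_mk (by fun_prop) _⟩
  let G : C(NonResultantPairs d m, NonResultantPairs (d + 2) m) :=
    ⟨fun p ↦ ⟨(mulNormSq d p.1.1, p.1.2), fun v hv h ↦ p.2 v hv ⟨by
      have := h.1
      rw [evalForm_mulNormSq] at this
      exact (mul_eq_zero.1 this).resolve_left (normSq_pos_of_ne_zero hv).ne', h.2⟩⟩,
      Continuous.subtype_mk (by fun_prop) _⟩
  refine ⟨⟨F, G, ?_, ?_⟩⟩
  · refine homotopic_of_evalForm_mul_pos _ _ (fun _ ↦ rfl) fun p v hv h ↦ ?_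
    change 0 < evalForm (d + 2) (mulNormSq d (Φ p)) v * evalForm (d + 2) p.1.1 v
    rw [evalForm_mulNormSq, mul_assoc, mul_comm (evalForm d _ v)]
    exact mul_pos (normSq_pos_of_ne_zero hv) (hΦ p v hv h)
  · refine homotopic_of_evalForm_mul_pos _ _ (fun _ ↦ rfl) fun p v hv h ↦ ?_
    change 0 < evalForm d (Φ (G p)) v * evalForm d p.1.1 v
    have h' : 0 < evalForm (d + 2) (mulNormSq d p.1.1) v * evalForm d (Φ (G p)) v :=
      hΦ (G p) v hv h
    rw [evalForm_mulNormSq, mul_assoc] at h'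
    rw [mul_comm]
    exact (mul_pos_iff_of_pos_left (normSq_pos_of_ne_zero hv)).1 h'

/-- Exchanging the two forms of a non-resultant pair. -/
def nonResultantPairsSwap (d m : ℕ) : NonResultantPairs d m ≃ₜ NonResultantPairs m d where
  toFun p := ⟨p.1.swap, fun v hv h ↦ p.2 v hv h.symm⟩
  invFun p := ⟨p.1.swap, fun v hv h ↦ p.2 v hv h.symm⟩
  left_inv _ := rfl
  right_inv _ := rfl
  continuous_toFun := Continuous.subtype_mk (continuous_swap.comp continuous_subtype_val) _
  continuous_invFun := Continuous.subtype_mk (continuous_swap.comp continuous_subtype_val) _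

lemma evalForm_degree_zero (a : Fin 1 → ℝ) (v : ℝ × ℝ) : evalForm 0 a v = a 0 := by
  simp [evalForm]

lemma NonResultantPairs.snd_ne_zero (p : NonResultantPairs 1 0) : p.1.2 0 ≠ 0 := by
  intro h
  by_cases ha : p.1.1 = 0
  · exact p.2 (1, 0) (by simp) ⟨by rw [ha, evalForm_zero_left], by rw [evalForm_degree_zero, h]⟩
  · refine p.2 (-p.1.1 1, p.1.1 0) (fun h0 ↦ ha ?_) ⟨?_, by rw [evalForm_degree_zero, h]⟩
    · simp only [Prod.mk_eq_zero, neg_eq_zero] at h0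
      ext i
      fin_cases i
      · exact h0.2
      · exact h0.1
    · simp [evalForm, Fin.sum_univ_two]
      ring

lemma nonempty_homotopyEquiv_nonResultantPairs_one_zero :
    Nonempty (ContinuousMap.HomotopyEquiv (NonResultantPairs 1 0) (Fin 2)) := by
  have hval : Continuous (Subtype.val : NonResultantPairs 1 0 → _) := continuous_subtype_val
  let s : Fin 2 → ℝ := ![-1, 1]
  have mem (a : Fin 2 → ℝ) (c : Fin 1 → ℝ) (hc : c 0 ≠ 0) (v : ℝ × ℝ) (_ : v ≠ 0) :
      ¬ (evalForm 1 a v = 0 ∧ evalForm 0 c v = 0) := fun h ↦ hc (by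
    rw [← h.2, evalForm_degree_zero])
  let F : C(NonResultantPairs 1 0, Fin 2) :=
    ⟨fun p ↦ if 0 < p.1.2 0 then 1 else 0, by
      refine IsLocallyConstant.continuous ((IsLocallyConstant.iff_eventually_eq _).2 fun p ↦ ?_)
      have hc : Continuous fun q : NonResultantPairs 1 0 ↦ q.1.2 0 := by fun_prop
      rcases lt_or_gt_of_ne p.snd_ne_zero with h | h
      · filter_upwards [hc.continuousAt.eventually_lt continuousAt_const h] with q hq
        rw [if_neg hq.not_gt, if_neg h.not_gt]
      · filter_upwards [continuousAt_const.eventually_lt hc.continuousAt h] with q hq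
        rw [if_pos hq, if_pos h]⟩
  let G : C(Fin 2, NonResultantPairs 1 0) :=
    ⟨fun i ↦ ⟨(0, fun _ ↦ s i), mem _ _ (by fin_cases i <;> simp [s])⟩,
      continuous_of_discreteTopology⟩
  refine ⟨⟨F, G, ⟨?_⟩, ?_⟩⟩
  · have hs : ∀ p, 0 < s (F p) * p.1.2 0 := fun p ↦ by
      rcases lt_or_gt_of_ne p.snd_ne_zero with h | h
      · simp [F, s, h.not_gt, h]
      · simp [F, s, h]
    refine ⟨⟨fun q ↦ ⟨((q.1 : ℝ) • q.2.1.1,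
      fun i ↦ (1 - (q.1 : ℝ)) * s (F q.2) + q.1 * q.2.1.2 i), mem _ _ ?_⟩, ?_⟩,
      fun p ↦ ?_, fun p ↦ ?_⟩
    · obtain ⟨⟨t, ht₀, ht₁⟩, p⟩ := q
      have h := hs p
      intro h₀
      dsimp only at h₀
      set A := s (F p)
      set B := p.1.2 0
      have hA : A ≠ 0 := left_ne_zero_of_mul h.ne'
      have hA2 : 0 < A ^ 2 := by positivity
      have h₃ : (1 - t) * A ^ 2 + t * (A * B) = 0 := by linear_combination A * h₀
      rcases ht₀.eq_or_lt with rfl | ht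
      · simp at h₃; exact hA h₃
      · nlinarith [mul_pos ht h, mul_nonneg (sub_nonneg.2 ht₁) hA2.le]
    · have hsF : Continuous fun p ↦ s (F p) :=
        (continuous_of_discreteTopology (f := s)).comp F.continuous
      exact Continuous.subtype_mk (by fun_prop) _
    · exact Subtype.ext (Prod.ext (by simp; rfl) (by simp; rfl))
    · exact Subtype.ext (by simp)
  · convert ContinuousMap.Homotopic.refl _
    have hFG (i : Fin 2) : F (G i) = i := by
      change (if 0 < s i then (1 : Fin 2) else 0) = i
      fin_cases i <;> simp [s]
    exact ContinuousMap.ext fun i ↦ (hFG i).symm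

theorem nonempty_homotopyEquiv_nonResultantPairs_fin_two {d m : ℕ} (h : d % 2 ≠ m % 2) :
    Nonempty (ContinuousMap.HomotopyEquiv (NonResultantPairs d m) (Fin 2)) := by
  induction hn : d + m using Nat.strong_induction_on generalizing d m with
  | _ n ih =>
    wlog hdm : m < d generalizing d m
    · obtain ⟨e⟩ := this (Ne.symm h) (by omega) (by omega)
      exact ⟨(nonResultantPairsSwap d m).toHomotopyEquiv.trans e⟩
    obtain rfl | ⟨k, rfl⟩ : d = 1 ∨ ∃ k, d = k + 2 := by
      obtain _ | _ | k := d
      · omega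
      · exact Or.inl rfl
      · exact Or.inr ⟨k, rfl⟩
    · obtain rfl : m = 0 := by omega
      exact nonempty_homotopyEquiv_nonResultantPairs_one_zero
    · obtain ⟨e⟩ := nonempty_homotopyEquiv_nonResultantPairs (d := k) (m := m) (by omega)
      obtain ⟨e'⟩ := ih (k + m) (by omega) (by omega : k % 2 ≠ m % 2) rfl
      exact ⟨e.trans e'⟩

end NonResultantPairs

/-- for `d₁ > d₂ ≥ 1` of different parities, the space of non-resultant pairs
of real binary forms of degrees `d₁, d₂` has exactly two connected components, each of which
has trivial reduced integer cohomology (`ℤ` in degree 0, trivial in higher degrees). -/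
theorem statement7 (d₁ d₂ : ℕ) (h21 : d₂ < d₁) (h2 : 1 ≤ d₂) (hpar : d₁ % 2 ≠ d₂ % 2) :
    Nonempty (ConnectedComponents (NonResultantPairs d₁ d₂) ≃ Fin 2) ∧
    ∀ x : NonResultantPairs d₁ d₂,
      Nonempty (singularCohomology ℤ (TopCat.of (connectedComponent x)) 0 ≃ₗ[ℤ] ℤ) ∧
      ∀ i : ℕ, 1 ≤ i →
        Subsingleton (singularCohomology ℤ (TopCat.of (connectedComponent x)) i) := by
  obtain ⟨e⟩ := nonempty_homotopyEquiv_nonResultantPairs_fin_two hpar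
  refine ⟨⟨e.connectedComponentsEquiv⟩, fun x ↦ ?_⟩
  have : ContractibleSpace (TopCat.of (connectedComponent x)) :=
    e.contractibleSpace_connectedComponent x
  exact ⟨singularCohomology_zero_of_contractible ℤ _, fun i hi ↦
    subsingleton_singularCohomology_of_contractible ℤ _ (by omega)⟩
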